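/- Fix integers n, N ≥ 1, a real number m > 0, Schwartz functions λ' on ℝ and λ'' on ℝ³, and signs ε_{M,j} ∈ {−1, +1} for 1 ≤ M ≤ N, 1 ≤ j ≤ n. For a = (a₁,…,a_n) ∈ (ℝ⁴)^n set κ(a) = (1/n) Σ_{j=1}^n a_j = (κ(a)⁰, 𝛋(a)) and G(a) = λ'(κ(a)⁰) λ''(𝛋(a)) exp( −(1/2) Σ_{j=1}^n |a_j − κ(a)|_E² ). Define F : ((ℝ⁴)^n)^N → ℂ by F(k₁,…,k_N) = ∫_{((ℝ⁴)^n)^N} ( ∏_{M=1}^{N−1} 𝟙[ κ(a_M)⁰ ≤ κ(a_{M+1})⁰ ] ) ( ∏_{M=1}^N G(a_M) ) exp( i Σ_{M=1}^N Σ_{j=1}^n ε_{M,j} k_{M,j} · a_{M,j} ) da₁⋯da_N, where · is the Minkowski pairing. Then: (i) the integral converges absolutely for every k and F is a bounded continuous function; (ii) the function ℝ^{3nN} → ℂ given by (𝐤_{M,j})_{M,j} ↦ F( (k̃_{M,j})_{M,j} ), where k̃ = (ω(𝐤),𝐤) and ω(𝐤) = √(|𝐤|² + m²), is a Schwartz function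 on ℝ^{3nN}. -/

import Mathlib

open MeasureTheory
open scoped BigOperators

/-- The Minkowski pairing `k·a = k⁰a⁰ − kk·𝐚` on ℝ⁴. -/
noncomputable def mink (k a : Fin 4 → ℝ) : ℝ :=
  k 0 * a 0 - (k 1 * a 1 + k 2 * a 2 + k 3 * a 3)

/-- The mean point `κ(a) = (1/n) Σ_j a_j` of `a ∈ (ℝ⁴)^n`. -/
noncomputable def meanPt {n : ℕ} (a : Fin n → Fin 4 → ℝ) : Fin 4 → ℝ :=
  (n : ℝ)⁻¹ • ∑ j, a j

/-- The Gaussian cutoff factor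
`G(a) = λ'(κ(a)⁰) λ''(𝛋(a)) exp(−(1/2) Σ_j |a_j − κ(a)|_E²)`. -/
noncomputable def gaussCutoff {n : ℕ} (lam' : SchwartzMap ℝ ℂ)
    (lam'' : SchwartzMap (Fin 3 → ℝ) ℂ) (a : Fin n → Fin 4 → ℝ) : ℂ :=
  lam' (meanPt a 0) * lam'' (fun i : Fin 3 => meanPt a i.succ) *
    (Real.exp (-(1/2) * ∑ j, ∑ μ : Fin 4, (a j μ - meanPt a μ) ^ 2) : ℂ)

/-- The integrand of the kernel `F`. -/
noncomputable def kernelFIntegrand (n N : ℕ) (lam' : SchwartzMap ℝ ℂ)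
    (lam'' : SchwartzMap (Fin 3 → ℝ) ℂ) (ε : Fin N → Fin n → ℝ)
    (k : Fin N → Fin n → Fin 4 → ℝ) (a : Fin N → Fin n → Fin 4 → ℝ) : ℂ :=
  Set.indicator {a : Fin N → Fin n → Fin 4 → ℝ |
      ∀ M L : Fin N, (M : ℕ) + 1 = (L : ℕ) → meanPt (a M) 0 ≤ meanPt (a L) 0}
    (fun a => (∏ M, gaussCutoff lam' lam'' (a M)) *
      Complex.exp (Complex.I *
        ((∑ M, ∑ j, ε M j * mink (k M j) (a M j) : ℝ) : ℂ))) a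

/-- The kernel `F(k₁,…,k_N)`. -/
noncomputable def kernelF (n N : ℕ) (lam' : SchwartzMap ℝ ℂ)
    (lam'' : SchwartzMap (Fin 3 → ℝ) ℂ) (ε : Fin N → Fin n → ℝ)
    (k : Fin N → Fin n → Fin 4 → ℝ) : ℂ :=
  ∫ a : Fin N → Fin n → Fin 4 → ℝ, kernelFIntegrand n N lam' lam'' ε k a

/-- Relativistic energy `ω(kk) = √(|kk|² + m²)`. -/
noncomputable def omegaM (m : ℝ) (k : Fin 3 → ℝ) : ℝ :=
  Real.sqrt ((∑ i, k i ^ 2) + m ^ 2)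

/-- The mass-shell point `k̃ = (ω(kk), kk) ∈ ℝ⁴`. -/
noncomputable def massShell (m : ℝ) (k : Fin 3 → ℝ) : Fin 4 → ℝ :=
  Fin.cons (omegaM m k) k


/-- Smooth functions whose derivatives decay rapidly relative to a weight. -/
def RelDecay {E : Type*} [NormedAddCommGroup E] [NormedSpace ℝ E] (p : E → ℝ) (f : E → ℂ) : Prop :=
  ContDiff ℝ (⊤ : ℕ∞) f ∧ ∀ k n : ℕ, ∃ C : ℝ, ∀ x, p x ^ k * ‖iteratedFDeriv ℝ n f x‖ ≤ C

lemma RelDecay.one {E : Type*} [NormedAddCommGroup E] [NormedSpace ℝ E] :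
    RelDecay (fun _ : E => (0 : ℝ)) (fun _ => (1 : ℂ)) := by
  refine ⟨contDiff_const, fun k n => ⟨1, fun x => ?_⟩⟩
  have h1 : ‖iteratedFDeriv ℝ n (fun _ : E => (1 : ℂ)) x‖ ≤ 1 := by
    rcases Nat.eq_zero_or_pos n with rfl | hn
    · simp
    · rw [iteratedFDeriv_const_of_ne (by omega)]; simp
  have h2 : (0 : ℝ) ^ k ≤ 1 := pow_le_one₀ le_rfl zero_le_one
  have h3 : (0 : ℝ) ≤ 0 ^ k := by positivity
  nlinarith [norm_nonneg (iteratedFDeriv ℝ n (fun _ : E => (1 : ℂ)) x)]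

lemma RelDecay.mul {E : Type*} [NormedAddCommGroup E] [NormedSpace ℝ E] {p q : E → ℝ} {f g : E → ℂ}
    (hf : RelDecay p f) (hg : RelDecay q g) (hp : ∀ x, 0 ≤ p x) (hq : ∀ x, 0 ≤ q x) :
    RelDecay (fun x => p x + q x) (fun x => f x * g x) := by
  refine ⟨hf.1.mul hg.1, fun k n => ?_⟩
  choose A hA using hf.2
  choose B hB using hg.2
  refine ⟨∑ i ∈ Finset.range (n + 1), 2 ^ (k-1) * ((n.choose i : ℝ) *
    (A k i * B 0 (n - i) + A 0 i * B k (n - i))), fun x => ?_⟩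
  have h1 := norm_iteratedFDeriv_mul_le (n := n) (N := (⊤ : ℕ∞)) hf.1 hg.1 x (by exact_mod_cast le_top)
  have h2 := add_pow_le (hp x) (hq x) k
  have hpq : 0 ≤ (p x + q x) ^ k := pow_nonneg (add_nonneg (hp x) (hq x)) k
  refine (mul_le_mul_of_nonneg_left h1 hpq).trans ?_
  rw [Finset.mul_sum]
  refine Finset.sum_le_sum fun i _ => ?_
  have a1 := hA k i x
  have a0 := hA 0 i x
  have b1 := hB k (n - i) x
  have b0 := hB 0 (n - i) x
  set u := ‖iteratedFDeriv ℝ i f x‖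
  set v := ‖iteratedFDeriv ℝ (n - i) g x‖
  have hu : 0 ≤ u := norm_nonneg _
  have hv : 0 ≤ v := norm_nonneg _
  have hpk := pow_nonneg (hp x) k
  have hqk := pow_nonneg (hq x) k
  simp only [pow_zero, one_mul] at a0 b0
  have c1 : (p x ^ k * u) * v ≤ A k i * B 0 (n - i) :=
    mul_le_mul a1 b0 hv ((by positivity : 0 ≤ p x ^ k * u).trans a1)
  have c2 : u * (q x ^ k * v) ≤ A 0 i * B k (n - i) :=
    mul_le_mul a0 b1 (by positivity) (hu.trans a0)
  calc (p x + q x) ^ k * ((n.choose i : ℝ) * u * v)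
      ≤ (2 ^ (k-1) * (p x ^ k + q x ^ k)) * ((n.choose i : ℝ) * u * v) := by gcongr
    _ = 2 ^ (k-1) * ((n.choose i : ℝ) * ((p x ^ k * u) * v + u * (q x ^ k * v))) := by ring
    _ ≤ _ := by gcongr

lemma RelDecay.prod {E : Type*} [NormedAddCommGroup E] [NormedSpace ℝ E] {ι : Type*} (s : Finset ι)
    {p : ι → E → ℝ} {f : ι → E → ℂ}
    (hf : ∀ i, RelDecay (p i) (f i)) (hp : ∀ i x, 0 ≤ p i x) :
    RelDecay (fun x => ∑ i ∈ s, p i x) (fun x => ∏ i ∈ s, f i x) := by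
  classical
  induction s using Finset.induction_on with
  | empty => simpa using RelDecay.one
  | insert a s ha ih =>
    simp only [Finset.sum_insert ha, Finset.prod_insert ha]
    exact (hf a).mul ih (hp a) (fun x => Finset.sum_nonneg fun i _ => hp i x)

lemma RelDecay.comp {E F : Type*} [NormedAddCommGroup E] [NormedSpace ℝ E]
    [NormedAddCommGroup F] [NormedSpace ℝ F] (φ : SchwartzMap F ℂ) (A : E →L[ℝ] F) :
    RelDecay (fun x => ‖A x‖) (fun x => φ (A x)) := by
  refine ⟨(φ.smooth ⊤).comp A.contDiff, fun k n => ?_⟩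
  obtain ⟨C, hC0, hC⟩ := φ.decay k n
  refine ⟨C * ‖A‖ ^ n, fun x => ?_⟩
  have h : iteratedFDeriv ℝ n (fun x => φ (A x)) x =
      (iteratedFDeriv ℝ n φ (A x)).compContinuousLinearMap (fun _ => A) :=
    A.iteratedFDeriv_comp_right (φ.smooth ⊤) x (by exact_mod_cast le_top)
  rw [h]
  have h2 := (iteratedFDeriv ℝ n φ (A x)).norm_compContinuousLinearMap_le (fun _ => A)
  simp only [Finset.prod_const, Finset.card_univ, Fintype.card_fin] at h2
  calc _ ≤ ‖A x‖ ^ k * (‖iteratedFDeriv ℝ n φ (A x)‖ * ‖A‖ ^ n) := by gcongr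
    _ = (‖A x‖ ^ k * ‖iteratedFDeriv ℝ n φ (A x)‖) * ‖A‖ ^ n := by ring
    _ ≤ _ := by gcongr; exact hC _

lemma RelDecay.exists_schwartz {E : Type*} [NormedAddCommGroup E] [NormedSpace ℝ E] {p : E → ℝ}
    {f : E → ℂ} (hf : RelDecay p f) (K : ℝ) (hK0 : 0 ≤ K) (hK : ∀ x, ‖x‖ ≤ K * p x) :
    ∃ g : SchwartzMap E ℂ, ∀ x, g x = f x := by
  refine ⟨⟨f, hf.1, fun k n => ?_⟩, fun x => rfl⟩
  obtain ⟨C, hC⟩ := hf.2 k n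
  refine ⟨K ^ k * C, fun x => ?_⟩
  calc ‖x‖ ^ k * ‖iteratedFDeriv ℝ n f x‖ ≤ (K * p x) ^ k * ‖iteratedFDeriv ℝ n f x‖ := by
        gcongr; exact hK x
    _ = K ^ k * (p x ^ k * ‖iteratedFDeriv ℝ n f x‖) := by ring
    _ ≤ _ := by gcongr; exact hC x

/-- A power times a Gaussian is bounded. -/
lemma pow_mul_gauss_bdd (k : ℕ) : ∃ C : ℝ, ∀ x : ℝ, |x| ^ k * Real.exp (-(x ^ 2 / 2)) ≤ C := by
  refine ⟨(k.factorial : ℝ) * Real.exp (1 / 2), fun x => ?_⟩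
  have h1 := Real.pow_div_factorial_le_exp |x| (abs_nonneg x) k
  rw [div_le_iff₀ (by positivity)] at h1
  calc |x| ^ k * Real.exp (-(x ^ 2 / 2)) ≤ (Real.exp |x| * k.factorial) * Real.exp (-(x ^ 2 / 2)) := by
        gcongr
    _ = k.factorial * Real.exp (|x| + -(x ^ 2 / 2)) := by rw [Real.exp_add]; ring
    _ ≤ _ := by
        gcongr
        nlinarith [sq_abs x, sq_nonneg (|x| - 1)]

lemma poly_mul_gauss_bdd (P : Polynomial ℝ) (k : ℕ) :
    ∃ C : ℝ, ∀ x : ℝ, |x| ^ k * (|P.eval x| * Real.exp (-(x ^ 2 / 2))) ≤ C := by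
  induction P using Polynomial.induction_on' with
  | add p q hp hq =>
    obtain ⟨A, hA⟩ := hp
    obtain ⟨B, hB⟩ := hq
    refine ⟨A + B, fun x => ?_⟩
    refine le_trans ?_ (add_le_add (hA x) (hB x))
    rw [← mul_add, ← add_mul, Polynomial.eval_add]
    gcongr
    exact abs_add_le _ _
  | monomial j c =>
    obtain ⟨C, hC⟩ := pow_mul_gauss_bdd (k + j)
    refine ⟨|c| * C, fun x => ?_⟩
    rw [Polynomial.eval_monomial, abs_mul, abs_pow]
    calc _ = |c| * (|x| ^ (k + j) * Real.exp (-(x ^ 2 / 2))) := by ring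
      _ ≤ _ := by gcongr; exact hC x

lemma exists_gauss_schwartz : ∃ g : SchwartzMap ℝ ℂ, ∀ x, g x = (Real.exp (-(x ^ 2 / 2)) : ℂ) := by
  have hs : ContDiff ℝ (⊤ : ℕ∞) (fun x : ℝ => Real.exp (-(x ^ 2 / 2))) := by fun_prop
  have key : ∀ k n : ℕ, ∃ C : ℝ, ∀ x : ℝ, ‖x‖ ^ k *
      ‖iteratedFDeriv ℝ n (fun x : ℝ => Real.exp (-(x ^ 2 / 2))) x‖ ≤ C := by
    intro k n
    obtain ⟨C, hC⟩ := poly_mul_gauss_bdd ((Polynomial.hermite n).map (Int.castRingHom ℝ)) k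
    refine ⟨C, fun x => ?_⟩
    rw [norm_iteratedFDeriv_eq_norm_iteratedDeriv, iteratedDeriv_eq_iterate,
      Polynomial.deriv_gaussian_eq_hermite_mul_gaussian]
    refine le_trans (le_of_eq ?_) (hC x)
    rw [Polynomial.aeval_def, Polynomial.eval_map]
    simp
  refine ⟨⟨fun x => (Real.exp (-(x ^ 2 / 2)) : ℂ), ?_, ?_⟩, fun x => rfl⟩
  · exact Complex.ofRealCLM.contDiff.comp hs
  · intro k n
    obtain ⟨C, hC⟩ := key k n
    refine ⟨C, fun x => ?_⟩
    have := Complex.ofRealLI.norm_iteratedFDeriv_comp_left (x := x) (n := (⊤ : ℕ∞)) hs.contDiffAt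
      (i := n) (by exact_mod_cast le_top)
    refine le_trans (le_of_eq ?_) (hC x)
    rw [← this]
    rfl

lemma exists_schwartz_prod_gauss {E F : Type*} [NormedAddCommGroup E] [NormedSpace ℝ E]
    [FiniteDimensional ℝ E]
    [NormedAddCommGroup F] [NormedSpace ℝ F] (φ : SchwartzMap F ℂ) {ι β : Type*} [Fintype ι]
    [Fintype β] (A : ι → E →L[ℝ] F) (B : β → E →L[ℝ] ℝ)
    (hinj : ∀ x, (∀ i, A i x = 0) → (∀ b, B b x = 0) → x = 0) :
    ∃ g : SchwartzMap E ℂ, ∀ x, g x =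
      (∏ i, φ (A i x)) * (Real.exp (-(1/2) * ∑ b, (B b x) ^ 2) : ℂ) := by
  obtain ⟨γ, hγ⟩ := exists_gauss_schwartz
  have h1 := (RelDecay.prod Finset.univ (fun i => RelDecay.comp φ (A i))
      (fun _ _ => norm_nonneg _)).mul
    (RelDecay.prod Finset.univ (fun b => RelDecay.comp γ (B b)) (fun _ _ => norm_nonneg _))
    (fun x => Finset.sum_nonneg fun i _ => norm_nonneg _)
    (fun x => Finset.sum_nonneg fun i _ => norm_nonneg _)
  let T : E →ₗ[ℝ] (ι → F) × (β → ℝ) :=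
    (LinearMap.pi fun i => (A i).toLinearMap).prod (LinearMap.pi fun b => (B b).toLinearMap)
  have hT : LinearMap.ker T = ⊥ := by
    rw [LinearMap.ker_eq_bot']
    intro x hx
    have hx1 : (fun i => A i x) = 0 := congrArg Prod.fst hx
    have hx2 : (fun b => B b x) = 0 := congrArg Prod.snd hx
    exact hinj x (fun i => congrFun hx1 i) (fun b => congrFun hx2 b)
  obtain ⟨K, hK0, hK⟩ := T.exists_antilipschitzWith hT
  obtain ⟨g, hg⟩ := h1.exists_schwartz K K.2 (fun x => by
    have h := hK.le_mul_dist x 0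
    rw [map_zero, dist_zero_right, dist_zero_right] at h
    refine h.trans (mul_le_mul_of_nonneg_left ?_ K.2)
    rw [Prod.norm_def]
    have s1 : 0 ≤ ∑ i, ‖A i x‖ := Finset.sum_nonneg fun i _ => norm_nonneg _
    have s2 : 0 ≤ ∑ i, ‖B i x‖ := Finset.sum_nonneg fun i _ => norm_nonneg _
    refine max_le ?_ ?_
    · refine le_trans ?_ (le_add_of_nonneg_right s2)
      refine (pi_norm_le_iff_of_nonneg s1).2 fun i => ?_
      exact Finset.single_le_sum (f := fun i => ‖A i x‖) (fun i _ => norm_nonneg _) (Finset.mem_univ i)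
    · refine le_trans ?_ (le_add_of_nonneg_left s1)
      refine (pi_norm_le_iff_of_nonneg s2).2 fun i => ?_
      exact Finset.single_le_sum (f := fun i => ‖B i x‖) (fun i _ => norm_nonneg _) (Finset.mem_univ i))
  refine ⟨g, fun x => ?_⟩
  rw [hg]
  congr 1
  rw [Finset.mul_sum, Real.exp_sum, Complex.ofReal_prod]
  refine Finset.prod_congr rfl fun b _ => ?_
  rw [hγ]
  congr 2
  ring

lemma haar_change {X Y : Type*} [NormedAddCommGroup X] [NormedSpace ℝ X] [FiniteDimensional ℝ X]
    [MeasureSpace X] [BorelSpace X] [NormedAddCommGroup Y] [NormedSpace ℝ Y]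
    [FiniteDimensional ℝ Y] [MeasureSpace Y] [BorelSpace Y]
    [(volume : Measure X).IsAddHaarMeasure] [(volume : Measure Y).IsAddHaarMeasure]
    (e : X ≃L[ℝ] Y) : ∃ c : NNReal, (∀ f : Y → ℂ, ∫ a, f (e a) = (c : ℂ) * ∫ y, f y) ∧
      ∀ f : Y → ℂ, Integrable f → Integrable (fun a => f (e a)) := by
  have h := Measure.isAddLeftInvariant_eq_smul ((volume : Measure X).map e) (volume : Measure Y)
  have hme : MeasurableEmbedding e := e.toHomeomorph.measurableEmbedding
  generalize Measure.addHaarScalarFactor ((volume : Measure X).map e) (volume : Measure Y) = c at h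
  refine ⟨c, fun f => ?_, fun f hf => ?_⟩
  · rw [← hme.integral_map, h, integral_smul_nnreal_measure]
    rfl
  · have : Integrable f ((volume : Measure X).map e) := by
      rw [h]; exact hf.smul_measure_nnreal
    exact (hme.integrable_map_iff).1 this

/-- Time components. -/
abbrev TSp (n N : ℕ) := EuclideanSpace ℝ (Fin N × Fin n)
/-- Space components. -/
abbrev SSp (n N : ℕ) := EuclideanSpace ℝ (Fin N × Fin n × Fin 3)

/-- Splitting in time and space components. -/
noncomputable def splitE (n N : ℕ) : (Fin N → Fin n → Fin 4 → ℝ) ≃L[ℝ] TSp n N × SSp n N :=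
  LinearEquiv.toContinuousLinearEquiv
  { toFun := fun a => (WithLp.toLp 2 fun p => a p.1 p.2 0, WithLp.toLp 2 fun p => a p.1 p.2.1 p.2.2.succ)
    invFun := fun y M j => Fin.cons (y.1 (M, j)) (fun i => y.2 (M, j, i))
    map_add' := fun a b => rfl
    map_smul' := fun c a => rfl
    left_inv := fun a => by
      funext M j μ
      refine Fin.cases ?_ (fun i => ?_) μ <;> simp
    right_inv := fun y => by
      ext p <;> simp }

lemma splitE_fst {n N : ℕ} (a : Fin N → Fin n → Fin 4 → ℝ) (M : Fin N) (j : Fin n) :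
    (splitE n N a).1 (M, j) = a M j 0 := rfl

lemma splitE_snd {n N : ℕ} (a : Fin N → Fin n → Fin 4 → ℝ) (M : Fin N) (j : Fin n) (i : Fin 3) :
    (splitE n N a).2 (M, j, i) = a M j i.succ := rfl

/-- mean of time components -/
noncomputable def tA (n N : ℕ) (M : Fin N) : TSp n N →L[ℝ] ℝ :=
  (n : ℝ)⁻¹ • ∑ j, EuclideanSpace.proj (M, j)

/-- mean of space components -/
noncomputable def sA (n N : ℕ) (M : Fin N) : SSp n N →L[ℝ] (Fin 3 → ℝ) :=
  ContinuousLinearMap.pi fun i => (n : ℝ)⁻¹ • ∑ j, EuclideanSpace.proj (M, j, i)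

lemma tA_apply (n N : ℕ) (M : Fin N) (t : TSp n N) : tA n N M t = (n : ℝ)⁻¹ * ∑ j, t (M, j) := by
  simp [tA]

lemma sA_apply (n N : ℕ) (M : Fin N) (t : SSp n N) (i : Fin 3) :
    sA n N M t i = (n : ℝ)⁻¹ * ∑ j, t (M, j, i) := by
  simp [sA]

lemma meanPt_zero {n N : ℕ} (a : Fin N → Fin n → Fin 4 → ℝ) (M : Fin N) :
    meanPt (a M) 0 = tA n N M (splitE n N a).1 := by
  rw [tA_apply]
  simp only [splitE_fst]
  simp [meanPt]

lemma meanPt_succ {n N : ℕ} (a : Fin N → Fin n → Fin 4 → ℝ) (M : Fin N) (i : Fin 3) :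
    meanPt (a M) i.succ = sA n N M (splitE n N a).2 i := by
  rw [sA_apply]
  simp only [splitE_snd]
  simp [meanPt]

lemma exists_time (n N : ℕ) (lam' : SchwartzMap ℝ ℂ) : ∃ Q : SchwartzMap (TSp n N) ℂ, ∀ t, Q t =
    (∏ M, lam' (tA n N M t)) *
      (Real.exp (-(1/2) * ∑ b : Fin N × Fin n, (t b - tA n N b.1 t) ^ 2) : ℂ) := by
  let B : Fin N × Fin n → TSp n N →L[ℝ] ℝ := fun b => EuclideanSpace.proj b - tA n N b.1
  have hB : ∀ b x, B b x = x b - tA n N b.1 x := fun b x => rfl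
  obtain ⟨g, hg⟩ := exists_schwartz_prod_gauss lam' (tA n N) B (by
    intro x h1 h2
    ext b
    have := h2 b
    rw [hB, h1] at this
    simpa using this)
  refine ⟨g, fun x => ?_⟩
  rw [hg]
  simp only [hB]

lemma exists_space (n N : ℕ) (lam'' : SchwartzMap (Fin 3 → ℝ) ℂ) :
    ∃ P : SchwartzMap (SSp n N) ℂ, ∀ x, P x =
    (∏ M, lam'' (sA n N M x)) *
      (Real.exp (-(1/2) * ∑ b : Fin N × Fin n × Fin 3, (x b - sA n N b.1 x b.2.2) ^ 2) : ℂ) := by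
  let B : Fin N × Fin n × Fin 3 → SSp n N →L[ℝ] ℝ := fun b => EuclideanSpace.proj b - (ContinuousLinearMap.proj b.2.2).comp (sA n N b.1)
  have hB : ∀ b x, B b x = x b - sA n N b.1 x b.2.2 := fun b x => rfl
  obtain ⟨g, hg⟩ := exists_schwartz_prod_gauss lam'' (sA n N) B (by
    intro x h1 h2
    ext b
    have := h2 b
    rw [hB, h1] at this
    simpa using this)
  refine ⟨g, fun x => ?_⟩
  rw [hg]
  simp only [hB]

lemma prod_gaussCutoff {n N : ℕ} (lam' : SchwartzMap ℝ ℂ) (lam'' : SchwartzMap (Fin 3 → ℝ) ℂ)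
    (Q : SchwartzMap (TSp n N) ℂ) (P : SchwartzMap (SSp n N) ℂ)
    (hQ : ∀ t, Q t = (∏ M, lam' (tA n N M t)) *
      (Real.exp (-(1/2) * ∑ b : Fin N × Fin n, (t b - tA n N b.1 t) ^ 2) : ℂ))
    (hP : ∀ x, P x = (∏ M, lam'' (sA n N M x)) *
      (Real.exp (-(1/2) * ∑ b : Fin N × Fin n × Fin 3, (x b - sA n N b.1 x b.2.2) ^ 2) : ℂ))
    (a : Fin N → Fin n → Fin 4 → ℝ) :
    ∏ M, gaussCutoff lam' lam'' (a M) = Q (splitE n N a).1 * P (splitE n N a).2 := by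
  rw [hQ, hP]
  simp only [gaussCutoff, Finset.prod_mul_distrib]
  have e1 : ∀ M, (fun i : Fin 3 => meanPt (a M) i.succ) = sA n N M (splitE n N a).2 :=
    fun M => funext fun i => meanPt_succ a M i
  simp only [e1, meanPt_zero]
  rw [← Complex.ofReal_prod, ← Real.exp_sum]
  have e2 : ∑ M, -(1/2) * ∑ j, ∑ μ : Fin 4, (a M j μ - meanPt (a M) μ) ^ 2 =
     (-(1/2) * ∑ b : Fin N × Fin n, ((splitE n N a).1 b - tA n N b.1 (splitE n N a).1) ^ 2) +
     (-(1/2) * ∑ b : Fin N × Fin n × Fin 3,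
        ((splitE n N a).2 b - sA n N b.1 (splitE n N a).2 b.2.2) ^ 2) := by
    rw [← mul_add, ← Finset.mul_sum]
    congr 1
    simp only [Fintype.sum_prod_type, Fin.sum_univ_succ (n := 3), ← Finset.sum_add_distrib,
      meanPt_zero, meanPt_succ]
    rfl
  rw [e2, Real.exp_add, Complex.ofReal_mul]
  ring

/-- frequency vectors -/
noncomputable def wT {n N : ℕ} (ε : Fin N → Fin n → ℝ) : (Fin N → Fin n → ℝ) →ₗ[ℝ] TSp n N where
  toFun u := WithLp.toLp 2 fun p => -(2 * Real.pi)⁻¹ * (ε p.1 p.2 * u p.1 p.2)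
  map_add' u v := by ext p; simp; ring
  map_smul' c v := by ext p; simp; ring

/-- frequency vectors -/
noncomputable def wS {n N : ℕ} (ε : Fin N → Fin n → ℝ) : (Fin N → Fin n → Fin 3 → ℝ) →ₗ[ℝ] SSp n N where
  toFun u := WithLp.toLp 2 fun p => (2 * Real.pi)⁻¹ * (ε p.1 p.2.1 * u p.1 p.2.1 p.2.2)
  map_add' u v := by ext p; simp; ring
  map_smul' c v := by ext p; simp; ring

lemma wS_ker {n N : ℕ} (ε : Fin N → Fin n → ℝ) (hε : ∀ M j, ε M j = 1 ∨ ε M j = -1) :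
    LinearMap.ker (wS ε) = ⊥ := by
  rw [LinearMap.ker_eq_bot']
  intro u hu
  funext M j i
  have h : (wS ε u) (M, j, i) = 0 := by rw [hu]; rfl
  have h' : (2 * Real.pi)⁻¹ * (ε M j * u M j i) = 0 := h
  have hp : (2 * Real.pi)⁻¹ ≠ 0 := by positivity
  have he : ε M j ≠ 0 := by rcases hε M j with h | h <;> rw [h] <;> norm_num
  simpa [hp, he, Real.pi_ne_zero] using h'

lemma phase {n N : ℕ} (ε : Fin N → Fin n → ℝ) (k a : Fin N → Fin n → Fin 4 → ℝ) :
    (∑ M, ∑ j, ε M j * mink (k M j) (a M j)) =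
      -2 * Real.pi * inner ℝ (splitE n N a).1 (wT ε fun M j => k M j 0) +
      -2 * Real.pi * inner ℝ (splitE n N a).2 (wS ε fun M j i => k M j i.succ) := by
  simp only [PiLp.inner_apply, Fintype.sum_prod_type, ← mul_add, ← Finset.sum_add_distrib]
  simp only [Finset.mul_sum]
  refine Finset.sum_congr rfl fun M _ => Finset.sum_congr rfl fun j _ => ?_
  have h1 : (wT ε fun M j => k M j 0) (M, j) = -(2 * Real.pi)⁻¹ * (ε M j * k M j 0) := rfl
  have h2 : ∀ i, (wS ε fun M j i => k M j i.succ) (M, j, i) = 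
    (2 * Real.pi)⁻¹ * (ε M j * k M j i.succ) := fun i => rfl
  have h3 : (splitE n N a).1 (M, j) = a M j 0 := rfl
  have h4 : ∀ i, (splitE n N a).2 (M, j, i) = a M j i.succ := fun i => rfl
  simp only [h1, h2, h3, h4, mink, Fin.sum_univ_three, RCLike.inner_apply, conj_trivial]
  have hp : Real.pi ≠ 0 := Real.pi_ne_zero
  have s0 : Fin.succ (0 : Fin 3) = 1 := rfl
  have s1 : Fin.succ (1 : Fin 3) = 2 := rfl
  have s2 : Fin.succ (2 : Fin 3) = 3 := rfl
  rw [s0, s1, s2]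
  field_simp
  ring

/-- time-ordered set -/
def ordSet (n N : ℕ) : Set (TSp n N) :=
  {t | ∀ M L : Fin N, (M : ℕ) + 1 = (L : ℕ) → tA n N M t ≤ tA n N L t}

lemma measurableSet_ordSet (n N : ℕ) : MeasurableSet (ordSet n N) := by
  have : ordSet n N = ⋂ M : Fin N, ⋂ L : Fin N, ⋂ _ : (M : ℕ) + 1 = (L : ℕ),
      {t | tA n N M t ≤ tA n N L t} := by
    ext t; simp [ordSet]
  rw [this]
  refine MeasurableSet.iInter fun M => MeasurableSet.iInter fun L => MeasurableSet.iInter fun _ => ?_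
  exact (isClosed_le (tA n N M).continuous (tA n N L).continuous).measurableSet

lemma integrand_eq {n N : ℕ} (lam' : SchwartzMap ℝ ℂ) (lam'' : SchwartzMap (Fin 3 → ℝ) ℂ)
    (Q : SchwartzMap (TSp n N) ℂ) (P : SchwartzMap (SSp n N) ℂ)
    (hQP : ∀ a : Fin N → Fin n → Fin 4 → ℝ, 
      ∏ M, gaussCutoff lam' lam'' (a M) = Q (splitE n N a).1 * P (splitE n N a).2)
    (ε : Fin N → Fin n → ℝ) (k a : Fin N → Fin n → Fin 4 → ℝ) :
    kernelFIntegrand n N lam' lam'' ε k a =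
      (Complex.exp (((-2 * Real.pi * inner ℝ (splitE n N a).1 (wT ε fun M j => k M j 0) : ℝ) : ℂ)
        * Complex.I) • (ordSet n N).indicator Q (splitE n N a).1) *
      (Complex.exp (((-2 * Real.pi * inner ℝ (splitE n N a).2 (wS ε fun M j i => k M j i.succ) : ℝ)
        : ℂ) * Complex.I) • P (splitE n N a).2) := by
  classical
  have hmem : (a ∈ {a : Fin N → Fin n → Fin 4 → ℝ |
      ∀ M L : Fin N, (M : ℕ) + 1 = (L : ℕ) → meanPt (a M) 0 ≤ meanPt (a L) 0}) ↔
      (splitE n N a).1 ∈ ordSet n N := by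
    simp only [Set.mem_ofPred_eq, ordSet, meanPt_zero]
  unfold kernelFIntegrand
  by_cases h : (splitE n N a).1 ∈ ordSet n N
  · rw [Set.indicator_of_mem (hmem.2 h), Set.indicator_of_mem h, hQP, phase, Complex.ofReal_add,
      mul_add, Complex.exp_add]
    simp only [smul_eq_mul, mul_comm Complex.I]
    ring
  · rw [Set.indicator_of_notMem (fun h' => h (hmem.1 h')), Set.indicator_of_notMem h]
    simp

lemma phase_integrable {E : Type*} [NormedAddCommGroup E] [NormedSpace ℝ E] [FiniteDimensional ℝ E]
    [MeasureSpace E] [BorelSpace E] {f : E → ℂ} (hf : Integrable f) (θ : E → ℝ)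
    (hθ : Continuous θ) : Integrable (fun x => Complex.exp ((θ x : ℂ) * Complex.I) • f x) := by
  have hc : Continuous (fun x => Complex.exp ((θ x : ℂ) * Complex.I)) := by fun_prop
  refine hf.mono (hc.aestronglyMeasurable.smul hf.1) (Filter.Eventually.of_forall fun x => ?_)
  rw [norm_smul, Complex.norm_exp_ofReal_mul_I, one_mul]

open FourierTransform in
lemma kernel_fact {n N : ℕ} (lam' : SchwartzMap ℝ ℂ) (lam'' : SchwartzMap (Fin 3 → ℝ) ℂ)
    (ε : Fin N → Fin n → ℝ) :
    ∃ (Q : SchwartzMap (TSp n N) ℂ) (P : SchwartzMap (SSp n N) ℂ) (c : ℂ),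
      (∀ k, Integrable (kernelFIntegrand n N lam' lam'' ε k)) ∧
      ∀ k, kernelF n N lam' lam'' ε k =
        c * (𝓕 ((ordSet n N).indicator Q) (wT ε fun M j => k M j 0) *
          𝓕 P (wS ε fun M j i => k M j i.succ)) := by
  obtain ⟨Q, hQ⟩ := exists_time n N lam'
  obtain ⟨P, hP⟩ := exists_space n N lam''
  have hI := integrand_eq lam' lam'' Q P (prod_gaussCutoff lam' lam'' Q P hQ hP) ε
  have i1 : (volume : Measure (Fin n → Fin 4 → ℝ)).IsAddHaarMeasure :=
    Measure.pi.isAddHaarMeasure _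
  have i2 : (volume : Measure (Fin N → Fin n → Fin 4 → ℝ)).IsAddHaarMeasure :=
    Measure.pi.isAddHaarMeasure _
  have i3 : (volume : Measure (TSp n N × SSp n N)).IsAddHaarMeasure :=
    Measure.prod.instIsAddHaarMeasure _ _
  obtain ⟨c, hc1, hc2⟩ := haar_change (splitE n N)
  refine ⟨Q, P, c, fun k => ?_, fun k => ?_⟩
  · rw [show kernelFIntegrand n N lam' lam'' ε k = _ from funext (hI k)]
    refine hc2 (fun y => 
      (Complex.exp (((-2 * Real.pi * inner ℝ y.1 (wT ε fun M j => k M j 0) : ℝ) : ℂ)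
        * Complex.I) • (ordSet n N).indicator Q y.1) *
      (Complex.exp (((-2 * Real.pi * inner ℝ y.2 (wS ε fun M j i => k M j i.succ) : ℝ)
        : ℂ) * Complex.I) • P y.2)) ?_
    refine Integrable.mul_prod (f := fun t => Complex.exp (((-2 * Real.pi * inner ℝ t (wT ε fun M j => k M j 0) : ℝ) : ℂ)
        * Complex.I) • (ordSet n N).indicator Q t) (g := fun x => Complex.exp (((-2 * Real.pi * inner ℝ x (wS ε fun M j i => k M j i.succ) : ℝ)
        : ℂ) * Complex.I) • P x) ?_ ?_
    · exact phase_integrable ((Q.integrable (μ := volume)).indicator (measurableSet_ordSet n N)) _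
        (by fun_prop)
    · exact phase_integrable (P.integrable (μ := volume)) _ (by fun_prop)
  · unfold kernelF
    simp_rw [hI k]
    rw [hc1 (fun y => 
      (Complex.exp (((-2 * Real.pi * inner ℝ y.1 (wT ε fun M j => k M j 0) : ℝ) : ℂ)
        * Complex.I) • (ordSet n N).indicator Q y.1) *
      (Complex.exp (((-2 * Real.pi * inner ℝ y.2 (wS ε fun M j i => k M j i.succ) : ℝ)
        : ℂ) * Complex.I) • P y.2))]
    rw [SchwartzMap.fourier_coe, Real.fourier_eq', Real.fourier_eq', ← integral_prod_mul]
    rfl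

open FourierTransform in
lemma fourier_temperate {n N : ℕ} (Q : SchwartzMap (TSp n N) ℂ) :
    (𝓕 ((ordSet n N).indicator Q) : TSp n N → ℂ).HasTemperateGrowth := by
  have hInt : ∀ j : ℕ, Integrable (fun v => ‖v‖ ^ j * ‖(ordSet n N).indicator Q v‖) := by
    intro j
    have := (Q.integrable_pow_mul volume j).indicator (measurableSet_ordSet n N)
    refine this.congr (Filter.Eventually.of_forall fun v => ?_)
    by_cases h : v ∈ ordSet n N <;> simp [h]
  have hm : AEStronglyMeasurable ((ordSet n N).indicator Q) :=
    Q.continuous.aestronglyMeasurable.indicator (measurableSet_ordSet n N)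
  refine ⟨Real.contDiff_fourier (N := ⊤) fun j _ => hInt j, fun j => ?_⟩
  refine ⟨0, ∫ v, ‖VectorFourier.fourierPowSMulRight (innerSL ℝ) ((ordSet n N).indicator Q) v j‖,
    fun x => ?_⟩
  rw [Real.iteratedFDeriv_fourier (N := ⊤) (fun j _ => hInt j) hm (by exact_mod_cast le_top)]
  simp only [pow_zero, mul_one]
  exact VectorFourier.norm_fourierIntegral_le_integral_norm _ _ _ _ _

lemma omega_temperate (m : ℝ) (hm : 0 < m) : (omegaM m).HasTemperateGrowth := by
  let e := (EuclideanSpace.equiv (Fin 3) ℝ).symm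
  have h : omegaM m = fun k => m * (1 + ‖(m⁻¹ • (e : (Fin 3 → ℝ) →L[ℝ] EuclideanSpace ℝ (Fin 3))) k‖ ^ 2) ^ (1/2 : ℝ) := by
    funext k
    have h1 : ‖(m⁻¹ • (e : (Fin 3 → ℝ) →L[ℝ] EuclideanSpace ℝ (Fin 3))) k‖ ^ 2 = (∑ i, k i ^ 2) / m ^ 2 := by
      rw [smul_apply, norm_smul, mul_pow, EuclideanSpace.norm_sq_eq]
      simp [e]
      field_simp
    rw [h1, ← Real.sqrt_eq_rpow, omegaM]
    have h2 : (∑ i, k i ^ 2) + m ^ 2 = m ^ 2 * (1 + (∑ i, k i ^ 2) / m ^ 2) := by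
      field_simp; ring
    rw [h2, Real.sqrt_mul (sq_nonneg m), Real.sqrt_sq hm.le]
  rw [h]
  have h3 := (Function.hasTemperateGrowth_one_add_norm_sq_rpow (EuclideanSpace ℝ (Fin 3)) (1/2)).comp
    (m⁻¹ • (e : (Fin 3 → ℝ) →L[ℝ] EuclideanSpace ℝ (Fin 3))).hasTemperateGrowth
  exact (Function.HasTemperateGrowth.const m).mul h3

lemma freq_temperate {n N : ℕ} (ε : Fin N → Fin n → ℝ) (m : ℝ) (hm : 0 < m) :
    (fun kk : Fin N → Fin n → Fin 3 → ℝ => wT ε fun M j => omegaM m (kk M j)).HasTemperateGrowth := by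
  have h : (fun kk : Fin N → Fin n → Fin 3 → ℝ => wT ε fun M j => omegaM m (kk M j)) =
      fun kk => ∑ M, ∑ j, omegaM m (kk M j) • wT ε (Pi.single M (Pi.single j 1)) := by
    funext kk
    simp only [← map_smul, ← map_sum]
    congr 1
    funext M j
    simp [Finset.sum_apply, Pi.single_apply, ite_apply, Finset.sum_ite_eq]
  rw [h]
  refine Function.HasTemperateGrowth.sum (f := fun M (kk : Fin N → Fin n → Fin 3 → ℝ) =>
    ∑ j, omegaM m (kk M j) • wT ε (Pi.single M (Pi.single j 1))) fun M _ => ?_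
  refine Function.HasTemperateGrowth.sum (f := fun j (kk : Fin N → Fin n → Fin 3 → ℝ) =>
    omegaM m (kk M j) • wT ε (Pi.single M (Pi.single j 1))) fun j _ => ?_
  let pr : (Fin N → Fin n → Fin 3 → ℝ) →L[ℝ] (Fin 3 → ℝ) :=
    (ContinuousLinearMap.proj (R := ℝ) (φ := fun _ : Fin n => Fin 3 → ℝ) j).comp
      (ContinuousLinearMap.proj (R := ℝ) (φ := fun _ : Fin N => Fin n → Fin 3 → ℝ) M)
  have h1 := (omega_temperate m hm).comp pr.hasTemperateGrowth
  exact h1.smul (Function.HasTemperateGrowth.const (wT ε (Pi.single M (Pi.single j 1))))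

open FourierTransform in
theorem kernelF_bounded_continuous_and_schwartz_on_shell (n N : ℕ)
    (hn : 1 ≤ n) (hN : 1 ≤ N) (m : ℝ) (hm : 0 < m)
    (lam' : SchwartzMap ℝ ℂ) (lam'' : SchwartzMap (Fin 3 → ℝ) ℂ)
    (ε : Fin N → Fin n → ℝ) (hε : ∀ M j, ε M j = 1 ∨ ε M j = -1) :
    (∀ k : Fin N → Fin n → Fin 4 → ℝ,
      Integrable (kernelFIntegrand n N lam' lam'' ε k)) ∧
    (∃ C : ℝ, ∀ k : Fin N → Fin n → Fin 4 → ℝ, ‖kernelF n N lam' lam'' ε k‖ ≤ C) ∧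
    Continuous (kernelF n N lam' lam'' ε) ∧
    (∃ g : SchwartzMap (Fin N → Fin n → Fin 3 → ℝ) ℂ,
      ∀ kk : Fin N → Fin n → Fin 3 → ℝ,
        g kk = kernelF n N lam' lam'' ε (fun M j => massShell m (kk M j))) := by
  obtain ⟨Q, P, c, hInt, hF⟩ := kernel_fact (n := n) (N := N) lam' lam'' ε
  have hT := fourier_temperate Q
  have hnorm : ∀ k a, ‖kernelFIntegrand n N lam' lam'' ε k a‖ =
      ‖kernelFIntegrand n N lam' lam'' ε 0 a‖ := by
    intro k a
    unfold kernelFIntegrand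
    rw [norm_indicator_eq_indicator_norm, norm_indicator_eq_indicator_norm]
    congr 1
    funext b
    rw [norm_mul, norm_mul, mul_comm Complex.I, mul_comm Complex.I,
      Complex.norm_exp_ofReal_mul_I, Complex.norm_exp_ofReal_mul_I]
  refine ⟨hInt, ⟨∫ a, ‖kernelFIntegrand n N lam' lam'' ε 0 a‖, fun k => ?_⟩, ?_, ?_⟩
  · refine (norm_integral_le_integral_norm _).trans (le_of_eq ?_)
    simp_rw [hnorm k]
  · rw [show kernelF n N lam' lam'' ε = _ from funext hF]
    have c1 : Continuous (𝓕 ((ordSet n N).indicator Q) : TSp n N → ℂ) := hT.1.continuous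
    have c2 : Continuous (wT ε) := (wT ε).continuous_of_finiteDimensional
    have c3 : Continuous (wS ε) := (wS ε).continuous_of_finiteDimensional
    have c4 : Continuous (𝓕 P : SchwartzMap (SSp n N) ℂ) := (𝓕 P).continuous
    refine continuous_const.mul ((c1.comp (c2.comp ?_)).mul (c4.comp (c3.comp ?_))) <;> fun_prop
  · obtain ⟨K, hK0, hK⟩ := (wS ε).exists_antilipschitzWith (wS_ker ε hε)
    have hw : (wS ε : _ → SSp n N).HasTemperateGrowth := (LinearMap.toContinuousLinearMap (wS ε)).hasTemperateGrowth
    have hg := hT.comp (freq_temperate ε m hm)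
    refine ⟨c • SchwartzMap.smulLeftCLM ℂ ((𝓕 ((ordSet n N).indicator Q) : TSp n N → ℂ) ∘
        (fun kk : Fin N → Fin n → Fin 3 → ℝ => wT ε fun M j => omegaM m (kk M j)))
      (SchwartzMap.compCLMOfAntilipschitz ℂ hw hK (𝓕 P)), fun kk => ?_⟩
    rw [hF, smul_apply, SchwartzMap.smulLeftCLM_apply_apply hg]
    rfl
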